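/- If 𝒦 is a complete additive category, then its free coproduct completion Σ𝒦 is cartesian closed. -/

import Mathlib

/- Common definitions for formalizing "How nice are free completions of categories?"
   by Adámek and Rosický. -/

open CategoryTheory CategoryTheory.Limits

universe w w₁ w₂ v₁ u₁

namespace FreeCompletions

/-- A presheaf is *small* if it is a colimit of representables over a small
(`Type w`-indexed) diagram. -/
def IsSmallPresheaf {C : Type u₁} [Category.{v₁} C] (F : Cᵒᵖ ⥤ Type v₁) : Prop :=
  ∃ (J : Type w) (_ : SmallCategory J) (D : J ⥤ C) (c : Cocone (D ⋙ yoneda)),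
    Nonempty (IsColimit c) ∧ Nonempty (c.pt ≅ F)

/-- A presheaf is a (small) coproduct of representables. -/
def IsCoproductOfRepresentables {C : Type u₁} [Category.{v₁} C] (F : Cᵒᵖ ⥤ Type v₁) : Prop :=
  ∃ (I : Type v₁) (A : I → C), Nonempty (F ≅ ∐ fun i => yoneda.obj (A i))

/-- The free coproduct completion `Σ𝒦`, realized as the full subcategory of presheaves
consisting of coproducts of representables. -/
abbrev SigmaCompletion (K : Type u₁) [Category.{v₁} K] :=
  ObjectProperty.FullSubcategory (IsCoproductOfRepresentables (C := K))

/-- The free colimit completion `𝒫𝒦`, the full subcategory of presheaves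
consisting of the small presheaves. -/
abbrev PCompletion (K : Type u₁) [Category.{v₁} K] :=
  ObjectProperty.FullSubcategory (IsSmallPresheaf.{v₁} (C := K))

/-- The object of `Σ𝒦` given by a small family of objects of `𝒦`. -/
noncomputable def famObj {K : Type u₁} [Category.{v₁} K] {I : Type v₁} (B : I → K) :
    SigmaCompletion K :=
  ⟨∐ fun i => yoneda.obj (B i), ⟨I, B, ⟨Iso.refl _⟩⟩⟩

theorem isSmallPresheaf_coprod {K : Type u₁} [Category.{v₁} K] {I : Type v₁} (B : I → K) :
    IsSmallPresheaf.{v₁} (∐ fun i => yoneda.obj (B i)) := by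
  let G := Discrete.functor (fun i => yoneda.obj (B i))
  let e : Discrete.functor B ⋙ yoneda ≅ G := Discrete.natIso (fun i => Iso.refl _)
  exact ⟨Discrete I, inferInstance, Discrete.functor B,
    (Cocone.precompose e.hom).obj (colimit.cocone G),
    ⟨(IsColimit.precomposeHomEquiv e (colimit.cocone G)).symm (colimit.isColimit G)⟩,
    ⟨Iso.refl _⟩⟩

/-- The object of `𝒫𝒦` given by a small coproduct of representables. -/
noncomputable def pcoprodObj {K : Type u₁} [Category.{v₁} K] {I : Type v₁} (B : I → K) :
    PCompletion K :=
  ⟨∐ fun i => yoneda.obj (B i), isSmallPresheaf_coprod B⟩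

/-- A diagram `D` has a *multi-limit*: a set of cones through which every cone
factorizes uniquely (unique member and unique factorization). -/
def HasMultiLimit {J : Type w₁} [Category.{w₂} J] {C : Type u₁} [Category.{v₁} C]
    (D : J ⥤ C) : Prop :=
  ∃ (T : Type w) (c : T → Cone D), ∀ s : Cone D,
    ∃ p : Σ t : T, s ⟶ c t, ∀ q : Σ t : T, s ⟶ c t, q = p

/-- `𝒦` is finitely multi-complete: every finite diagram has a multi-limit. -/
def FinitelyMultiComplete (C : Type u₁) [Category.{v₁} C] : Prop :=
  ∀ (J : Type) [SmallCategory J] [FinCategory J] (D : J ⥤ C), HasMultiLimit.{v₁} D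

/-- A family `A : I → C` has a *multi-product*: a set of cones through which every cone
factorizes uniquely (unique member and unique factorization). -/
def HasMultiProduct {C : Type u₁} [Category.{v₁} C] {I : Type w₁} (A : I → C) : Prop :=
  ∃ (T : Type w) (P : T → C) (π : ∀ t i, P t ⟶ A i),
    ∀ (X : C) (f : ∀ i, X ⟶ A i),
      ∃ p : Σ t : T, X ⟶ P t, (∀ i, p.2 ≫ π p.1 i = f i) ∧
        ∀ q : Σ t : T, X ⟶ P t, (∀ i, q.2 ≫ π q.1 i = f i) → q = p

/-- `C` has multi-products of all set-indexed families. -/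
def HasMultiProducts (C : Type u₁) [Category.{v₁} C] : Prop :=
  ∀ (I : Type v₁) (A : I → C), HasMultiProduct.{v₁} A

/-- A diagram `D` has a *pre-limit*: a set of cones through which every cone
factorizes (not necessarily uniquely). -/
def HasPreLimit {J : Type w₁} [Category.{w₂} J] {C : Type u₁} [Category.{v₁} C]
    (D : J ⥤ C) : Prop :=
  ∃ (T : Type w) (c : T → Cone D), ∀ s : Cone D, ∃ t : T, Nonempty (s ⟶ c t)

/-- `C` is pre-complete: every small diagram has a pre-limit. -/
def PreComplete (C : Type u₁) [Category.{v₁} C] : Prop :=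
  ∀ (J : Type v₁) [SmallCategory J] (D : J ⥤ C), HasPreLimit.{v₁} D

/-- `C` is finitely pre-complete: every finite diagram has a pre-limit. -/
def FinitelyPreComplete (C : Type u₁) [Category.{v₁} C] : Prop :=
  ∀ (J : Type) [SmallCategory J] [FinCategory J] (D : J ⥤ C), HasPreLimit.{v₁} D

/-- A family `A : I → C` has a *pre-product*: a set of cones through which every cone
factorizes (not necessarily uniquely). -/
def HasPreProduct {C : Type u₁} [Category.{v₁} C] {I : Type w₁} (A : I → C) : Prop :=
  ∃ (T : Type w) (P : T → C) (π : ∀ t i, P t ⟶ A i),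
    ∀ (X : C) (f : ∀ i, X ⟶ A i), ∃ (t : T) (h : X ⟶ P t), ∀ i, h ≫ π t i = f i

/-- `C` (with finite products) is cartesian multi-closed: each functor `A × -` is a
left multi-adjoint. -/
def CartesianMultiClosedOf (C : Type u₁) [Category.{v₁} C] [HasFiniteProducts C] : Prop :=
  ∀ A B : C, ∃ (I : Type v₁) (E : I → C) (ev : ∀ i, A ⨯ E i ⟶ B),
    ∀ (X : C) (c : A ⨯ X ⟶ B),
      ∃ p : Σ i : I, X ⟶ E i, (prod.map (𝟙 A) p.2 ≫ ev p.1 = c) ∧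
        ∀ q : Σ i : I, X ⟶ E i, prod.map (𝟙 A) q.2 ≫ ev q.1 = c → q = p

/-- `C` is cartesian multi-closed: it has finite products and each functor `A × -` is a
left multi-adjoint. -/
def CartesianMultiClosed (C : Type u₁) [Category.{v₁} C] : Prop :=
  ∃ h : HasFiniteProducts C, @CartesianMultiClosedOf C _ h

/-- `C` is cartesian closed (as a property: it has finite products and each `A × -`
is a left adjoint). -/
def CartesianClosedP (C : Type u₁) [Category.{v₁} C] : Prop :=
  ∃ h : CartesianMonoidalCategory C, Nonempty (@MonoidalClosed C _ h.toMonoidalCategory)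

/-- `C` is locally cartesian closed: every slice category is cartesian closed. -/
def LocallyCartesianClosedP (C : Type u₁) [Category.{v₁} C] : Prop :=
  ∀ A : C, CartesianClosedP (Over A)

/-- `C` is locally cartesian multi-closed: every slice category is cartesian multi-closed. -/
def LocallyCartesianMultiClosed (C : Type u₁) [Category.{v₁} C] : Prop :=
  ∀ A : C, CartesianMultiClosed (Over A)

/-- `C` (with finite products) is cartesian pre-closed: each functor `C(A × -, B)`
is a small presheaf. -/
def CartesianPreClosedOf (C : Type u₁) [Category.{v₁} C] [HasFiniteProducts C] : Prop :=
  ∀ A B : C, IsSmallPresheaf.{w} ((prod.functor.obj A).op ⋙ yoneda.obj B)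

/-- `C` is cartesian pre-closed: it has finite products and each functor `C(A × -, B)`
is a small presheaf. -/
def CartesianPreClosed (C : Type u₁) [Category.{v₁} C] : Prop :=
  ∃ h : HasFiniteProducts C, @CartesianPreClosedOf.{w} C _ h

/-- `C` (with binary products) has weak simple products. -/
def HasWeakSimpleProductsOf (C : Type u₁) [Category.{v₁} C] [HasBinaryProducts C] : Prop :=
  ∀ (A X B : C) (b : B ⟶ A ⨯ X),
    ∃ (P : C) (ε : A ⨯ P ⟶ B) (w : P ⟶ X),
      ε ≫ b = prod.map (𝟙 A) w ∧
      ∀ (P' : C) (ε' : A ⨯ P' ⟶ B) (w' : P' ⟶ X), ε' ≫ b = prod.map (𝟙 A) w' →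
        ∃ f : P' ⟶ P, ε' = prod.map (𝟙 A) f ≫ ε ∧ w' = f ≫ w

/-- `C` has binary products and weak simple products. -/
def HasWeakSimpleProducts (C : Type u₁) [Category.{v₁} C] : Prop :=
  ∃ h : HasBinaryProducts C, @HasWeakSimpleProductsOf C _ h

/-- `C` has a subobject classifier: a mono `ε : 1 ⟶ Ω` from the terminal object such that
every monomorphism is a pullback of `ε` along a unique morphism. -/
def HasSubobjectClassifierP (C : Type u₁) [Category.{v₁} C] : Prop :=
  ∃ (T Ω : C) (hT : IsTerminal T) (ε : T ⟶ Ω), Mono ε ∧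
    ∀ ⦃U X : C⦄ (m : U ⟶ X), Mono m → ∃! χ : X ⟶ Ω, IsPullback (hT.from U) m ε χ

/-- `C` is an elementary topos: finitely complete, cartesian closed,
with a subobject classifier. -/
def IsElementaryTopos (C : Type u₁) [Category.{v₁} C] : Prop :=
  HasFiniteLimits C ∧ CartesianClosedP C ∧ HasSubobjectClassifierP C

/-- `C` is a multi-topos: finitely complete, cartesian multi-closed,
with a subobject classifier. -/
def IsMultiTopos (C : Type u₁) [Category.{v₁} C] : Prop :=
  HasFiniteLimits C ∧ CartesianMultiClosed C ∧ HasSubobjectClassifierP C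

/-- A coproduct cocone is *universal*: it is stable under pullback. -/
def CofanUniversal {C : Type u₁} [Category.{v₁} C] {I : Type w₁} {X : I → C}
    (c : Cofan X) : Prop :=
  ∀ {W : C} (h : W ⟶ c.pt) (Y : I → C) (p : ∀ i, Y i ⟶ W) (q : ∀ i, Y i ⟶ X i),
    (∀ i, IsPullback (p i) (q i) h (c.inj i)) → Nonempty (IsColimit (Cofan.mk W p))

/-- A coproduct cocone is *disjoint*: injections are monic with initial pairwise
intersections. -/
def CofanDisjoint {C : Type u₁} [Category.{v₁} C] {I : Type w₁} {X : I → C}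
    (c : Cofan X) : Prop :=
  (∀ i, Mono (c.inj i)) ∧
    ∀ i j, i ≠ j → ∀ {Z : C} (u : Z ⟶ X i) (v : Z ⟶ X j),
      IsPullback u v (c.inj i) (c.inj j) → Nonempty (IsInitial Z)

/-- `C` is extensive: finitely complete, with finite coproducts which are
universal and disjoint. -/
def IsExtensive (C : Type u₁) [Category.{v₁} C] : Prop :=
  HasFiniteLimits C ∧ HasFiniteCoproducts C ∧
    ∀ (I : Type) [Finite I] (X : I → C) (c : Cofan X),
      Nonempty (IsColimit c) → CofanUniversal c ∧ CofanDisjoint c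

/-- `C` is infinitary extensive: finitely complete, with small (`Type w`-indexed)
coproducts which are universal and disjoint. -/
def IsInfinitaryExtensive (C : Type u₁) [Category.{v₁} C] : Prop :=
  HasFiniteLimits C ∧ HasCoproducts.{w} C ∧
    ∀ (I : Type w) (X : I → C) (c : Cofan X),
      Nonempty (IsColimit c) → CofanUniversal c ∧ CofanDisjoint c

/-- A parallel pair `r₁ r₂ : R ⟶ X` is an (internal) equivalence relation. -/
structure IsEquivalenceRelationPair {C : Type u₁} [Category.{v₁} C] {R X : C}
    (r₁ r₂ : R ⟶ X) : Prop where
  jointlyMono : ∀ {Z : C} (a b : Z ⟶ R), a ≫ r₁ = b ≫ r₁ → a ≫ r₂ = b ≫ r₂ → a = b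
  refl : ∀ {Z : C} (f : Z ⟶ X), ∃ d : Z ⟶ R, d ≫ r₁ = f ∧ d ≫ r₂ = f
  symm : ∃ s : R ⟶ R, s ≫ r₁ = r₂ ∧ s ≫ r₂ = r₁
  trans : ∀ {Z : C} (a b : Z ⟶ R), a ≫ r₂ = b ≫ r₁ →
    ∃ t : Z ⟶ R, t ≫ r₁ = a ≫ r₁ ∧ t ≫ r₂ = b ≫ r₂

/-- `C` is a regular category: finitely complete, with (regular epi, mono)
factorizations, and regular epimorphisms are stable under pullback. -/
def IsRegularCat (C : Type u₁) [Category.{v₁} C] : Prop :=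
  HasFiniteLimits C ∧
    (∀ {X Y : C} (f : X ⟶ Y), ∃ (Z : C) (e : X ⟶ Z) (m : Z ⟶ Y),
      e ≫ m = f ∧ Nonempty (RegularEpi e) ∧ Mono m) ∧
    (∀ {P X Y Z : C} (fst : P ⟶ X) (snd : P ⟶ Y) (f : X ⟶ Z) (g : Y ⟶ Z),
      IsPullback fst snd f g → Nonempty (RegularEpi g) → Nonempty (RegularEpi fst))

/-- `C` is an exact (Barr-exact) category: regular with effective equivalence relations. -/
def IsExactCat (C : Type u₁) [Category.{v₁} C] : Prop :=
  IsRegularCat C ∧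
    ∀ {R X : C} (r₁ r₂ : R ⟶ X), IsEquivalenceRelationPair r₁ r₂ →
      ∃ (Y : C) (f : X ⟶ Y), IsPullback r₁ r₂ f f

/-- A pretopos is an exact and extensive category. -/
def IsPretopos (C : Type u₁) [Category.{v₁} C] : Prop :=
  IsExactCat C ∧ IsExtensive C

/-- `C` is additive: preadditive with finite biproducts. -/
def IsAdditive (C : Type u₁) [Category.{v₁} C] : Prop :=
  ∃ p : Preadditive C, letI := p; HasFiniteBiproducts C

/-- `C` is wellpowered: every object has only a set of subobjects. -/
def Wellpowered (C : Type u₁) [Category.{v₁} C] : Prop :=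
  ∀ X : C, Small.{w} (Subobject X)

/-- `C` is cowellpowered: every object has only a set of quotient objects. -/
def Cowellpowered (C : Type u₁) [Category.{v₁} C] : Prop :=
  ∀ X : C, Small.{w} (Subobject (Opposite.op X))

/-- `C` has a clique-like class of objects, indexed by all ordinals. -/
def HasCliqueLikeClass (C : Type u₁) [Category.{v₁} C] : Prop :=
  ∃ (A : Ordinal.{v₁} → C) (R : MorphismProperty C),
    (∀ {X Y Z : C} (v : X ⟶ Y) (u : Y ⟶ Z), R (v ≫ u) → R u) ∧
    (∀ k, ∃ f g : A 0 ⟶ A k, f ≠ g ∧ R f ∧ R g) ∧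
    ((∀ i k : Ordinal.{v₁}, 0 < i → i < k → ∀ f : A k ⟶ A i, ¬ R f) ∨
     (∀ k i : Ordinal.{v₁}, 0 < k → k < i → ∀ f : A k ⟶ A i, ¬ R f))

/-- A presheaf is petty: a quotient of a small coproduct of representables. -/
def IsPetty {C : Type u₁} [Category.{v₁} C] (F : Cᵒᵖ ⥤ Type v₁) : Prop :=
  ∃ (I : Type v₁) (A : I → C) (e : (∐ fun i => yoneda.obj (A i)) ⟶ F), Epi e

/-- A presheaf is lucid: petty, and equalizers of pairs of morphisms from petty
presheaves into it are petty. -/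
noncomputable def IsLucid {C : Type u₁} [Category.{v₁} C] (F : Cᵒᵖ ⥤ Type v₁) : Prop :=
  IsPetty F ∧ ∀ (P : Cᵒᵖ ⥤ Type v₁), IsPetty P → ∀ u₁ u₂ : P ⟶ F, IsPetty (equalizer u₁ u₂)

universe v u

section Helpers

variable {K : Type u} [Category.{v} K]

/-- The presheaf `U ↦ Σ i, (U ⟶ X i)` attached to a formal coproduct. -/
def famPresheaf (X : FormalCoproduct.{v} K) : Kᵒᵖ ⥤ Type v where
  obj U := Σ i : X.I, (U.unop ⟶ X.obj i)
  map f := TypeCat.ofHom fun p => ⟨p.1, f.unop ≫ p.2⟩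

/-- The functor from formal coproducts to presheaves. -/
def famFunctor (K : Type u) [Category.{v} K] : FormalCoproduct.{v} K ⥤ (Kᵒᵖ ⥤ Type v) where
  obj X := famPresheaf X
  map {X Y} g :=
    { app := fun U => TypeCat.ofHom fun (p : Σ i : X.I, (U.unop ⟶ X.obj i)) =>
        (⟨g.f p.1, p.2 ≫ g.φ p.1⟩ : Σ i : Y.I, (U.unop ⟶ Y.obj i))
      naturality := fun U V f => by
        ext ⟨i, p⟩
        change (⟨g.f i, (f.unop ≫ p) ≫ g.φ i⟩ : Σ i : Y.I, (V.unop ⟶ Y.obj i)) =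
          ⟨g.f i, f.unop ≫ p ≫ g.φ i⟩
        simp }
  map_id X := by
    ext U ⟨i, p⟩
    change (⟨i, p ≫ 𝟙 _⟩ : Σ i : X.I, (U.unop ⟶ X.obj i)) = ⟨i, p⟩
    simp
  map_comp {X Y Z} f g := by
    ext U ⟨i, p⟩
    change (⟨g.f (f.f i), p ≫ f.φ i ≫ g.φ (f.f i)⟩ : Σ i : Z.I, (U.unop ⟶ Z.obj i)) =
      ⟨g.f (f.f i), (p ≫ f.φ i) ≫ g.φ (f.f i)⟩
    simp

theorem famFunctor_map_app {X Y : FormalCoproduct.{v} K} (g : X ⟶ Y) (U : Kᵒᵖ)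
    (i : X.I) (p : U.unop ⟶ X.obj i) :
    ((famFunctor K).map g).app U (⟨i, p⟩ : Σ i : X.I, (U.unop ⟶ X.obj i)) =
      (⟨g.f i, p ≫ g.φ i⟩ : Σ i : Y.I, (U.unop ⟶ Y.obj i)) := rfl

theorem fam_hom_ext_sigma {X Y : FormalCoproduct.{v} K} {f g : X ⟶ Y}
    (h : ∀ i, (⟨f.f i, f.φ i⟩ : Σ j : Y.I, (X.obj i ⟶ Y.obj j)) = ⟨g.f i, g.φ i⟩) : f = g := by
  obtain ⟨f, F⟩ := f
  obtain ⟨g, G⟩ := g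
  obtain rfl : f = g := funext fun i => congrArg Sigma.fst (h i)
  obtain rfl : F = G := funext fun i => by simpa using h i
  rfl

instance : (famFunctor K).Faithful where
  map_injective {X Y f g} h := by
    apply fam_hom_ext_sigma
    intro i
    have := ConcreteCategory.congr_hom (NatTrans.congr_app h (Opposite.op (X.obj i)))
      (⟨i, 𝟙 _⟩ : Σ j : X.I, (X.obj i ⟶ X.obj j))
    rw [famFunctor_map_app, famFunctor_map_app] at this
    simp only [Category.id_comp] at this
    exact this

instance : (famFunctor K).Full where
  map_surjective {X Y} α := by
    let t (i : X.I) : Σ j : Y.I, (X.obj i ⟶ Y.obj j) :=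
      α.app (Opposite.op (X.obj i)) (⟨i, 𝟙 _⟩ : Σ j : X.I, (X.obj i ⟶ X.obj j))
    refine ⟨⟨fun i => (t i).1, fun i => (t i).2⟩, ?_⟩
    ext U ⟨i, p⟩
    refine (famFunctor_map_app _ _ _ _).trans ?_
    have := NatTrans.naturality_apply α p.op
      (⟨i, 𝟙 _⟩ : Σ j : X.I, (X.obj i ⟶ X.obj j))
    refine this.symm.trans ?_
    refine congrArg (α.app U) ?_
    change (⟨i, p ≫ 𝟙 _⟩ : Σ j : X.I, (U.unop ⟶ X.obj j)) = ⟨i, p⟩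
    simp

/-- The canonical cofan exhibiting `famPresheaf` as a coproduct of representables. -/
def famCofan (X : FormalCoproduct.{v} K) : Cofan fun i => yoneda.obj (X.obj i) :=
  Cofan.mk (famPresheaf X) fun i =>
    { app := fun U => TypeCat.ofHom fun (p : U.unop ⟶ X.obj i) =>
        (⟨i, p⟩ : Σ i : X.I, (U.unop ⟶ X.obj i))
      naturality := fun U V f => by
        ext p
        simp [famPresheaf] }

/-- `famCofan` is a colimit. -/
def famCofanIsColimit (X : FormalCoproduct.{v} K) : IsColimit (famCofan X) :=
  Cofan.IsColimit.mk _
    (fun s =>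
      { app := fun U => TypeCat.ofHom fun (p : Σ i : X.I, (U.unop ⟶ X.obj i)) =>
          (s.inj p.1).app U p.2
        naturality := fun U V f => by
          ext ⟨i, p⟩
          exact NatTrans.naturality_apply (s.inj i) f p })
    (fun s i => by
      ext U p
      rfl)
    (fun s m h => by
      ext U ⟨i, p⟩
      exact ConcreteCategory.congr_hom (NatTrans.congr_app (h i) U) p)

/-- The comparison functor to the completion. -/
def famToSigma (K : Type u) [Category.{v} K] : FormalCoproduct.{v} K ⥤ SigmaCompletion K :=
  ObjectProperty.lift _ (famFunctor K) fun X =>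
    ⟨X.I, X.obj, ⟨(famCofanIsColimit X).coconePointUniqueUpToIso (colimit.isColimit _)⟩⟩

instance : (famToSigma K).Full := 
  Functor.Full.of_comp_faithful_iso (F := famToSigma K) (G := ObjectProperty.ι _)
    (H := famFunctor K) (Iso.refl _)
instance : (famToSigma K).Faithful := 
  Functor.Faithful.of_comp_iso (F := famToSigma K) (G := ObjectProperty.ι _)
    (H := famFunctor K) (Iso.refl _)
instance : (famToSigma K).EssSurj where
  mem_essImage F := by
    obtain ⟨I, A, ⟨e⟩⟩ := F.property
    exact ⟨⟨I, A⟩, ⟨ObjectProperty.isoMk _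
      ((famCofanIsColimit ⟨I, A⟩).coconePointUniqueUpToIso (colimit.isColimit _) ≪≫ e.symm)⟩⟩

instance : (famToSigma K).IsEquivalence where

attribute [local instance] HasBinaryBiproducts.of_hasBinaryProducts

variable [HasLimits K] [Preadditive K] [HasFiniteBiproducts K]

/-- Binary products of formal coproducts. -/
noncomputable def famProd (X Y : FormalCoproduct.{v} K) : LimitCone (pair X Y) where
  cone := BinaryFan.mk (P := (⟨X.I × Y.I, fun p => X.obj p.1 ⊞ Y.obj p.2⟩ : FormalCoproduct.{v} K))
    ⟨Prod.fst, fun _ => biprod.fst⟩ ⟨Prod.snd, fun _ => biprod.snd⟩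
  isLimit := BinaryFan.IsLimit.mk _
    (fun f g => ⟨fun i => (f.f i, g.f i), fun i => biprod.lift (f.φ i) (g.φ i)⟩)
    (fun f g => fam_hom_ext_sigma fun i => by simp)
    (fun f g => fam_hom_ext_sigma fun i => by simp)
    (fun f g m hf hg => by
      subst hf hg
      refine fam_hom_ext_sigma fun i => ?_
      dsimp
      congr 1
      ext <;> simp)

/-- The cartesian structure on formal coproducts. -/
noncomputable abbrev famCartesian (K : Type u) [Category.{v} K] [HasLimits K] [Preadditive K]
    [HasFiniteBiproducts K] : CartesianMonoidalCategory (FormalCoproduct.{v} K) :=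
  CartesianMonoidalCategory.ofChosenFiniteProducts
    ⟨_, FormalCoproduct.isTerminalIncl (⊤_ K) terminalIsTerminal⟩ famProd

attribute [local instance] famCartesian

/-- Exponentials of formal coproducts. -/
noncomputable def famExp (A B : FormalCoproduct.{v} K) : FormalCoproduct.{v} K where
  I := ∀ a : A.I, Σ b : B.I, (A.obj a ⟶ B.obj b)
  obj p := ∏ᶜ fun a => B.obj (p a).1

/-- Explicit products of formal coproducts. -/
noncomputable abbrev famTensor (A X : FormalCoproduct.{v} K) : FormalCoproduct.{v} K :=
  ⟨A.I × X.I, fun p => A.obj p.1 ⊞ X.obj p.2⟩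

theorem famExp_aux (A B : FormalCoproduct.{v} K) (U : K) (p q : (famExp A B).I)
    (h : ∀ a, p a = q a) (f : U ⟶ (famExp A B).obj p) (g : U ⟶ (famExp A B).obj q)
    (hfg : ∀ a, (⟨(p a).1, f ≫ Pi.π (fun a => B.obj (p a).1) a⟩ : Σ b : B.I, (U ⟶ B.obj b)) =
      ⟨(q a).1, g ≫ Pi.π (fun a => B.obj (q a).1) a⟩) :
    (⟨p, f⟩ : Σ p, (U ⟶ (famExp A B).obj p)) = ⟨q, g⟩ := by
  obtain rfl : p = q := funext h
  congr 1
  refine Pi.hom_ext _ _ fun a => ?_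
  exact eq_of_heq (Sigma.mk.inj (hfg a)).2

theorem sigma_biprod_aux (B : FormalCoproduct.{v} K) (U V : K) (b : B.I) (f g : U ⊞ V ⟶ B.obj b)
    (h₁ : biprod.inl ≫ f = biprod.inl ≫ g) (h₂ : biprod.inr ≫ f = biprod.inr ≫ g) :
    (⟨b, f⟩ : Σ b, (U ⊞ V ⟶ B.obj b)) = ⟨b, g⟩ := by
  congr 1
  ext <;> assumption

/-- The currying bijection. -/
noncomputable def famCurry (A X B : FormalCoproduct.{v} K) :
    (famTensor A X ⟶ B) ≃ (X ⟶ famExp A B) where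
  toFun g := ⟨fun x a => ⟨g.f (a, x), biprod.inl ≫ g.φ (a, x)⟩,
    fun x => Pi.lift fun a => biprod.inr ≫ g.φ (a, x)⟩
  invFun g := ⟨fun p => (g.f p.2 p.1).1,
    fun p => biprod.desc (g.f p.2 p.1).2 (g.φ p.2 ≫ Pi.π (fun a => B.obj (g.f p.2 a).1) p.1)⟩
  left_inv g := fam_hom_ext_sigma fun p => by
    refine sigma_biprod_aux _ _ _ _ _ _ ?_ ?_
    · simp
    · simp only [biprod.inr_desc]
      exact Pi.lift_π _ _
  right_inv g := fam_hom_ext_sigma fun x => by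
    refine famExp_aux _ _ _ _ _ ?_ _ _ ?_
    · intro a
      simp
    · intro a
      simp only [biprod.inr_desc]
      exact congrArg (Sigma.mk _) (Pi.lift_π _ _)

theorem famCurry_natural (A X' X B : FormalCoproduct.{v} K) (f : X' ⟶ X)
    (g : famTensor A X ⟶ B) :
    famCurry A X' B ((⟨fun p => (p.1, f.f p.2), fun p => biprod.map (𝟙 _) (f.φ p.2)⟩ :
      famTensor A X' ⟶ famTensor A X) ≫ g) = f ≫ famCurry A X B g := by
  refine fam_hom_ext_sigma fun x => ?_
  refine famExp_aux _ _ _ _ _ ?_ _ _ ?_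
  · intro a
    simp [famCurry]
  · intro a
    simp only [famCurry, Equiv.coe_fn_mk, FormalCoproduct.category_comp_f,
      FormalCoproduct.category_comp_φ, biprod.inr_map_assoc]
    refine congrArg (Sigma.mk _) ((Pi.lift_π _ _).trans ?_)
    refine ((Category.assoc _ _ _).trans ?_).symm
    exact congrArg (f.φ x ≫ ·) (Pi.lift_π _ _)

theorem famWhisker (A X' X : FormalCoproduct.{v} K) (f : X' ⟶ X) :
    (MonoidalCategory.tensorLeft A).map f =
      (⟨fun p => (p.1, f.f p.2), fun p => biprod.map (𝟙 _) (f.φ p.2)⟩ :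
      famTensor A X' ⟶ famTensor A X) := by
  refine BinaryFan.IsLimit.hom_ext (famProd A X).isLimit ?_ ?_
  · refine (CartesianMonoidalCategory.whiskerLeft_fst A f).trans ?_
    refine fam_hom_ext_sigma fun i => ?_
    change (⟨i.1, biprod.fst⟩ : Σ j : A.I, ((famTensor A X').obj i ⟶ A.obj j)) = ⟨i.1, biprod.map (𝟙 _) _ ≫ biprod.fst⟩
    simp
  · refine (CartesianMonoidalCategory.whiskerLeft_snd A f).trans ?_
    refine fam_hom_ext_sigma fun i => ?_
    change (⟨f.f i.2, biprod.snd ≫ _⟩ : Σ j : X.I, ((famTensor A X').obj i ⟶ X.obj j)) =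
      ⟨f.f i.2, biprod.map (𝟙 _) _ ≫ biprod.snd⟩
    simp only [biprod.map_snd]
    rfl

/-- Formal coproducts are cartesian closed. -/
@[reducible]
noncomputable def famClosed (K : Type u) [Category.{v} K] [HasLimits K] [Preadditive K]
    [HasFiniteBiproducts K] : MonoidalClosed (FormalCoproduct.{v} K) where
  closed A :=
    { rightAdj := _
      adj := Adjunction.adjunctionOfEquivRight (F := MonoidalCategory.tensorLeft A)
        (fun X B => famCurry A X B) fun X' X B f g => by
          rw [famWhisker]
          exact famCurry_natural A X' X B f g }

end Helpers

/-- Corollary 2.10: `Σ𝒦` is cartesian closed for every complete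
additive category `𝒦`. -/
theorem sigmaCompletion_cartesianClosed_of_additive (K : Type u) [Category.{v} K]
    [HasLimits K] [Preadditive K] [HasFiniteBiproducts K] :
    CartesianClosedP (SigmaCompletion K) := by
  let := famCartesian K
  let := famClosed K
  let e := (famToSigma K).asEquivalence
  have : HasFiniteProducts (SigmaCompletion K) :=
    ⟨fun n => Adjunction.hasLimitsOfShape_of_equivalence e.inverse⟩
  let h : CartesianMonoidalCategory (SigmaCompletion K) := .ofHasFiniteProducts
  exact ⟨h, ⟨cartesianClosedOfEquiv e⟩⟩
end FreeCompletions
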